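/- (Optimality of the greedy charging protocol, Appendix A.) Suppose α = 1 and Δ·P ≥ B (lossless battery, inactive power constraint). Then there exists an initial state x(0) ∈ [0, B] such that the total peaker energy ∑_{n=1}^N g(n) of the trajectory produced by the greedy charging protocol started from x(0) equals the infimum of the total peaker energy over all feasible trajectories with parameters (B, P). -/

import Mathlib

open Finset

/-- A feasible trajectory for a battery with energy rating `B`, power rating `P`,
loss factor `α`, time step `Δ`, wind `w` and demand `d`, over time horizon `N`:
state `x : {0,…,N} → ℝ`, peaker energy `g` and lost wind energy `l` on `{1,…,N}`. -/
def Feasible (N : ℕ) (Δ α B P : ℝ) (w d : ℕ → ℝ) (x g l : ℕ → ℝ) : Prop :=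
  (∀ n, 1 ≤ n → n ≤ N → 0 ≤ g n) ∧
  (∀ n, 1 ≤ n → n ≤ N → 0 ≤ l n) ∧
  (∀ m, m ≤ N → 0 ≤ x m ∧ x m ≤ B) ∧
  (∀ n, 1 ≤ n → n ≤ N → |x n - α * x (n - 1)| ≤ Δ * P) ∧
  (∀ n, 1 ≤ n → n ≤ N → x n = α * x (n - 1) + (w n - d n) + (g n - l n))

/-- Battery state sequence of the greedy charging protocol:
`x(n)` is `α·x(n−1) + (w n − d n)` clamped to
`[max(0, α·x(n−1) − Δ·P), min(B, α·x(n−1) + Δ·P)]`. -/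
noncomputable def greedyX (Δ α B P : ℝ) (w d : ℕ → ℝ) (x0 : ℝ) : ℕ → ℝ
  | 0 => x0
  | n + 1 =>
      min (min B (α * greedyX Δ α B P w d x0 n + Δ * P))
        (max (max 0 (α * greedyX Δ α B P w d x0 n - Δ * P))
          (α * greedyX Δ α B P w d x0 n + (w (n + 1) - d (n + 1))))

/-- Peaker energy of the greedy charging protocol. -/
noncomputable def greedyG (Δ α B P : ℝ) (w d : ℕ → ℝ) (x0 : ℝ) (n : ℕ) : ℝ :=
  if w n < d n then
    greedyX Δ α B P w d x0 n - α * greedyX Δ α B P w d x0 (n - 1) + (d n - w n)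
  else 0

/-- Lost wind energy of the greedy charging protocol. -/
noncomputable def greedyL (Δ α B P : ℝ) (w d : ℕ → ℝ) (x0 : ℝ) (n : ℕ) : ℝ :=
  if d n < w n then
    -(greedyX Δ α B P w d x0 n - α * greedyX Δ α B P w d x0 (n - 1) + (d n - w n))
  else 0

/-- With an inactive power constraint and no losses, the greedy state stays in `[0, B]`. -/
theorem greedyX_mem {Δ B P : ℝ} (hB : 0 ≤ B) (hPB : B ≤ Δ * P) (w d : ℕ → ℝ) {x0 : ℝ}
    (h0 : 0 ≤ x0) (h1 : x0 ≤ B) (n : ℕ) :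
    0 ≤ greedyX Δ 1 B P w d x0 n ∧ greedyX Δ 1 B P w d x0 n ≤ B := by
  induction n with
  | zero => exact ⟨h0, h1⟩
  | succ n ih =>
    rw [greedyX]
    exact ⟨le_min (le_min hB (by linarith)) (le_max_of_le_left (le_max_left _ _)),
      (min_le_left _ _).trans (min_le_left _ _)⟩

/-- With an inactive power constraint and no losses, the greedy update is clamping to `[0, B]`. -/
theorem greedyX_succ_eq_clamp {Δ B P : ℝ} (hB : 0 ≤ B) (hPB : B ≤ Δ * P) (w d : ℕ → ℝ) {x0 : ℝ}
    (h0 : 0 ≤ x0) (h1 : x0 ≤ B) (n : ℕ) :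
    greedyX Δ 1 B P w d x0 (n + 1) =
      min B (max 0 (greedyX Δ 1 B P w d x0 n + (w (n + 1) - d (n + 1)))) := by
  obtain ⟨h2, h3⟩ := greedyX_mem hB hPB w d h0 h1 n
  rw [greedyX, one_mul, min_eq_left (show B ≤ greedyX Δ 1 B P w d x0 n + Δ * P by linarith),
    max_eq_left (show greedyX Δ 1 B P w d x0 n - Δ * P ≤ 0 by linarith)]

/-- The greedy trajectory is feasible. -/
theorem feasible_greedy (N : ℕ) {Δ B P : ℝ} (hB : 0 ≤ B) (hPB : B ≤ Δ * P) (w d : ℕ → ℝ)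
    {x0 : ℝ} (h0 : 0 ≤ x0) (h1 : x0 ≤ B) :
    Feasible N Δ 1 B P w d (greedyX Δ 1 B P w d x0) (greedyG Δ 1 B P w d x0)
      (greedyL Δ 1 B P w d x0) := by
  have hmem := greedyX_mem hB hPB w d h0 h1
  have hstep := greedyX_succ_eq_clamp hB hPB w d h0 h1
  refine ⟨fun n hn _ => ?_, fun n hn _ => ?_, fun m _ => hmem m, fun n hn _ => ?_,
    fun n hn _ => ?_⟩ <;> obtain ⟨n, rfl⟩ := Nat.exists_eq_add_of_le' hn <;>
    have hn0 := hmem n <;> have hn1 := hmem (n + 1) <;> have hs := hstep n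
  · grind [greedyG]
  · grind [greedyL]
  · rw [Nat.add_sub_cancel, abs_le]
    constructor <;> linarith
  · grind [greedyG, greedyL]

/-- Started from a full battery, the greedy protocol has spent no more peaker energy than any
feasible trajectory, even after crediting the latter for its additional stored energy. -/
theorem greedy_sum_le {N : ℕ} {Δ B P : ℝ} (hB : 0 ≤ B) (hPB : B ≤ Δ * P) {w d x g l : ℕ → ℝ}
    (h : Feasible N Δ 1 B P w d x g l) (n : ℕ) (hn : n ≤ N) :
    ∑ i ∈ Icc 1 n, greedyG Δ 1 B P w d B i ≤ ∑ i ∈ Icc 1 n, g i ∧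
      ∑ i ∈ Icc 1 n, greedyG Δ 1 B P w d B i + (x n - greedyX Δ 1 B P w d B n) ≤
        ∑ i ∈ Icc 1 n, g i := by
  obtain ⟨hg, hl, hx, -, hxs⟩ := h
  induction n with
  | zero => simpa [greedyX] using (hx 0 hn).2
  | succ n ih =>
    obtain ⟨ih1, ih2⟩ := ih (by lia)
    have hgn := hg (n + 1) (by lia) hn
    have hln := hl (n + 1) (by lia) hn
    have hxn := hx (n + 1) hn
    have hxsn := hxs (n + 1) (by lia) hn
    have hy := greedyX_mem hB hPB w d hB le_rfl n
    have hs := greedyX_succ_eq_clamp hB hPB w d hB le_rfl n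
    rw [Finset.sum_Icc_succ_top (by lia), Finset.sum_Icc_succ_top (by lia)]
    simp only [greedyG, Nat.add_sub_cancel, one_mul] at hxsn ih1 ih2 ⊢
    grind

/-- Optimality of the greedy charging protocol (Appendix A): if `α = 1` and
`Δ·P ≥ B`, then some initial state `x0 ∈ [0, B]` makes the total peaker energy of
the greedy trajectory equal the infimum of the total peaker energy over all feasible
trajectories with parameters `(B, P)`. -/
theorem stmt19 (N : ℕ) (hN : 1 ≤ N) (Δ : ℝ) (hΔ : 0 < Δ)
    (B P : ℝ) (hB : 0 ≤ B) (hP : 0 ≤ P) (hPB : B ≤ Δ * P)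
    (w d : ℕ → ℝ) :
    ∃ x0 : ℝ, 0 ≤ x0 ∧ x0 ≤ B ∧
      ∑ n ∈ Icc 1 N, greedyG Δ 1 B P w d x0 n =
        sInf {S : ℝ | ∃ x g l : ℕ → ℝ,
          Feasible N Δ 1 B P w d x g l ∧ S = ∑ n ∈ Icc 1 N, g n} := by
  refine ⟨B, hB, le_rfl, (IsLeast.csInf_eq ⟨?_, ?_⟩).symm⟩
  · exact ⟨_, _, _, feasible_greedy N hB hPB w d hB le_rfl, rfl⟩
  · rintro _ ⟨x, g, l, h, rfl⟩
    exact (greedy_sum_le hB hPB h N le_rfl).1
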